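/- Let κ be a multivariate measure of concordance, C an n-copula, and R, S, T pairwise disjoint subsets partitioning {1,...,n} with cardinalities r, s, t. Then ∑_{j=s}^{n-t} (-1)^{r+j} 𝔄_j^R(C_T) = ∑_{j=r}^{n-t} (-1)^{s+j} 𝔄_j^S(C_T), where 𝔄_j^S(C_T) = r_{n-t} r_{n-t-1} ⋯ r_j ∑_{P ∈ (S \ T)(n-j-t)} κ_j(C_{P ∪ T}). -/

import Mathlib

open MeasureTheory Filter

noncomputable section

/-- The unit cube `I^n ⊆ ℝ^n`. -/
def cube (n : ℕ) : Set (Fin n → ℝ) := Set.univ.pi fun _ => Set.Icc (0:ℝ) 1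

/-- The box `[0,x] = [0,x_1] × ⋯ × [0,x_n]`. -/
def box {n : ℕ} (x : Fin n → ℝ) : Set (Fin n → ℝ) := Set.univ.pi fun i => Set.Icc 0 (x i)

/-- `C` is an `n`-copula: on `I^n` it is the box-distribution function of a probability
measure all of whose one-dimensional margins are uniform on `[0,1]`. -/
def IsCopula {n : ℕ} (C : (Fin n → ℝ) → ℝ) : Prop :=
  ∃ μ : Measure (Fin n → ℝ), IsProbabilityMeasure μ ∧
    (∀ x ∈ cube n, C x = (μ (box x)).toReal) ∧
    (∀ i : Fin n, μ.map (fun y => y i) = volume.restrict (Set.Icc (0:ℝ) 1))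

/-- The action `τ*(C) = C ∘ τ` of a coordinate permutation (with index permutation `τ`). -/
def permTrans {n : ℕ} (τ : Equiv.Perm (Fin n)) (C : (Fin n → ℝ) → ℝ) : (Fin n → ℝ) → ℝ :=
  fun x => C fun i => x (τ i)

/-- The action `σ_S*(C)(x) = μ_C(σ_S([0,x]))` of the reflection `σ_S`, written out by
inclusion–exclusion in terms of the values of `C`. -/
def reflTrans {n : ℕ} (S : Finset (Fin n)) (C : (Fin n → ℝ) → ℝ) : (Fin n → ℝ) → ℝ :=
  fun x => ∑ T ∈ S.powerset, (-1 : ℝ) ^ T.card *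
    C (fun i => if i ∈ T then 1 - x i else if i ∈ S then 1 else x i)

/-- The comonotone copula `M(t_1,…,t_n) = min(t_1,…,t_n)`. -/
def Mcop (n : ℕ) : (Fin n → ℝ) → ℝ := fun x => iInf x

/-- The independence copula `Π(t_1,…,t_n) = t_1 ⋯ t_n`. -/
def Pcop (n : ℕ) : (Fin n → ℝ) → ℝ := fun x => ∏ i, x i

/-- The proper `(n - card P)`-copula of the extended marginal `C_P` of `C`:
coordinates in `P` are set equal to `1` and the remaining coordinates are relabelled
in increasing order. -/
def properMarg {n : ℕ} (C : (Fin n → ℝ) → ℝ) (P : Finset (Fin n)) :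
    (Fin (Pᶜ.card) → ℝ) → ℝ :=
  fun y => C fun i => if h : i ∈ Pᶜ then y ((Pᶜ.orderIsoOfFin rfl).symm ⟨i, h⟩) else 1

/-- A multivariate measure of concordance `κ = ({κ_n},{r_n})` in the sense of Taylor:
normalization, monotonicity, continuity, permutation invariance, duality, the
reflection symmetry property and the transition property, extended by `κ_0 = κ_1 = 0`. -/
structure ConcordanceMeasure where
  κ : (n : ℕ) → ((Fin n → ℝ) → ℝ) → ℝ
  r : ℕ → ℝ
  kappa_zero : ∀ C, κ 0 C = 0
  kappa_one : ∀ C, κ 1 C = 0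
  normM : ∀ n, 2 ≤ n → κ n (Mcop n) = 1
  normPi : ∀ n, 2 ≤ n → κ n (Pcop n) = 0
  mono : ∀ n, 2 ≤ n → ∀ A B : (Fin n → ℝ) → ℝ, IsCopula A → IsCopula B →
    (∀ x ∈ cube n, A x ≤ B x) →
    (∀ x ∈ cube n, reflTrans Finset.univ A x ≤ reflTrans Finset.univ B x) →
    κ n A ≤ κ n B
  cont : ∀ n, 2 ≤ n → ∀ (C : (Fin n → ℝ) → ℝ) (Cm : ℕ → (Fin n → ℝ) → ℝ),
    IsCopula C → (∀ m, IsCopula (Cm m)) →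
    TendstoUniformlyOn Cm C atTop (cube n) →
    Tendsto (fun m => κ n (Cm m)) atTop (nhds (κ n C))
  permInv : ∀ n, 2 ≤ n → ∀ C : (Fin n → ℝ) → ℝ, IsCopula C →
    ∀ τ : Equiv.Perm (Fin n), κ n (permTrans τ C) = κ n C
  duality : ∀ n, 2 ≤ n → ∀ C : (Fin n → ℝ) → ℝ, IsCopula C →
    κ n (reflTrans Finset.univ C) = κ n C
  rsp : ∀ n, 2 ≤ n → ∀ C : (Fin n → ℝ) → ℝ, IsCopula C →
    ∑ S : Finset (Fin n), κ n (reflTrans S C) = 0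
  transition : ∀ n, 2 ≤ n → ∀ (C : (Fin n → ℝ) → ℝ) (E : (Fin (n+1) → ℝ) → ℝ),
    IsCopula C → IsCopula E →
    (∀ x ∈ cube n, C x = E (fun i : Fin (n+1) =>
      if h : (i : ℕ) = 0 then 1 else x ⟨(i : ℕ) - 1, by have := i.isLt; omega⟩)) →
    r n * κ n C = κ (n+1) E + κ (n+1) (reflTrans {0} E)


/-- The quantity `𝔄_j^S(C_T) = r_{n-t} ⋯ r_j ∑_{P ∈ (S∖T)(n-j-t)} κ_j(C_{P∪T})`. -/
def frakA (κ : ConcordanceMeasure) {n : ℕ} (C : (Fin n → ℝ) → ℝ)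
    (S T : Finset (Fin n)) (j : ℕ) : ℝ :=
  (∏ k ∈ Finset.Icc j (n - T.card), κ.r k) *
    ∑ P ∈ (S \ T).powersetCard (n - j - T.card),
      κ.κ ((P ∪ T)ᶜ.card) (properMarg C (P ∪ T))

/-- The distribution function of `μ`, evaluated on boxes `[0,x]`. -/
def boxCdf {n : ℕ} (μ : Measure (Fin n → ℝ)) : (Fin n → ℝ) → ℝ :=
  fun x => μ.real (box x)

/-- `μ` is a probability measure with uniform one-dimensional margins. -/
def IsCopulaMeasure {n : ℕ} (μ : Measure (Fin n → ℝ)) : Prop :=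
  IsProbabilityMeasure μ ∧
    ∀ i : Fin n, μ.map (fun y => y i) = volume.restrict (Set.Icc (0:ℝ) 1)

/-- The reflection `y_i ↦ 1 - y_i` in the coordinates of `S`. -/
def reflPoint {n : ℕ} (S : Finset (Fin n)) (y : Fin n → ℝ) : Fin n → ℝ :=
  fun i => if i ∈ S then 1 - y i else y i

/-- The image of `μ` under the reflection in the coordinates of `S`. -/
def reflMeasure {n : ℕ} (S : Finset (Fin n)) (μ : Measure (Fin n → ℝ)) :
    Measure (Fin n → ℝ) := μ.map (reflPoint S)

/-- The image of `μ` under the selection of coordinates `f`. -/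
def margMeasure {k n : ℕ} (f : Fin k → Fin n) (μ : Measure (Fin n → ℝ)) :
    Measure (Fin k → ℝ) := μ.map (fun y => y ∘ f)

lemma measurableSet_box {n : ℕ} (x : Fin n → ℝ) : MeasurableSet (box x) :=
  MeasurableSet.univ_pi fun _ => measurableSet_Icc

lemma measurable_reflPoint {n : ℕ} (S : Finset (Fin n)) : Measurable (reflPoint S) := by
  refine measurable_pi_lambda _ fun i => ?_
  by_cases h : i ∈ S <;> simp only [reflPoint, h, if_true, if_false] <;> fun_prop

lemma measurable_comp_index {k n : ℕ} (f : Fin k → Fin n) :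
    Measurable (fun y : Fin n → ℝ => y ∘ f) :=
  measurable_pi_lambda _ fun i => measurable_pi_apply (f i)

lemma IsCopulaMeasure.isCopula {n : ℕ} {μ : Measure (Fin n → ℝ)} (hμ : IsCopulaMeasure μ) :
    IsCopula (boxCdf μ) :=
  ⟨μ, hμ.1, fun _ _ => rfl, hμ.2⟩

lemma IsCopula.exists_measure {n : ℕ} {C : (Fin n → ℝ) → ℝ} (hC : IsCopula C) :
    ∃ μ, IsCopulaMeasure μ ∧ ∀ x ∈ cube n, C x = boxCdf μ x := by
  obtain ⟨μ, h1, h2, h3⟩ := hC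
  exact ⟨μ, ⟨h1, h3⟩, h2⟩

lemma IsCopula.congr {n : ℕ} {C D : (Fin n → ℝ) → ℝ} (hC : IsCopula C)
    (h : ∀ x ∈ cube n, D x = C x) : IsCopula D := by
  obtain ⟨μ, h1, h2, h3⟩ := hC
  exact ⟨μ, h1, fun x hx => (h x hx).trans (h2 x hx), h3⟩

lemma IsCopulaMeasure.marg {k n : ℕ} {μ : Measure (Fin n → ℝ)} (hμ : IsCopulaMeasure μ)
    (f : Fin k → Fin n) : IsCopulaMeasure (margMeasure f μ) := by
  have := hμ.1
  refine ⟨Measure.isProbabilityMeasure_map (measurable_comp_index f).aemeasurable, fun i => ?_⟩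
  rw [margMeasure, Measure.map_map (measurable_pi_apply i) (measurable_comp_index f)]
  exact hμ.2 (f i)

lemma map_one_sub_restrict_Icc :
    (volume.restrict (Set.Icc (0:ℝ) 1)).map (fun x => 1 - x) =
      volume.restrict (Set.Icc (0:ℝ) 1) := by
  have h := (Measure.measurePreserving_sub_left (volume : Measure ℝ) 1).restrict_preimage
    (s := Set.Icc (0:ℝ) 1) measurableSet_Icc
  have hpre : (fun x : ℝ => 1 - x) ⁻¹' Set.Icc 0 1 = Set.Icc 0 1 := by simp
  rw [hpre] at h
  exact h.map_eq

lemma IsCopulaMeasure.refl {n : ℕ} {μ : Measure (Fin n → ℝ)} (hμ : IsCopulaMeasure μ)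
    (S : Finset (Fin n)) : IsCopulaMeasure (reflMeasure S μ) := by
  have := hμ.1
  refine ⟨Measure.isProbabilityMeasure_map (measurable_reflPoint S).aemeasurable, fun i => ?_⟩
  rw [reflMeasure, Measure.map_map (measurable_pi_apply i) (measurable_reflPoint S)]
  by_cases h : i ∈ S
  · have : (fun y : Fin n → ℝ => y i) ∘ reflPoint S = (fun x => 1 - x) ∘ fun y => y i := by
      ext y; simp [reflPoint, h]
    rw [this, ← Measure.map_map (by fun_prop : Measurable fun x : ℝ => 1 - x) (measurable_pi_apply i),
      hμ.2 i,
      map_one_sub_restrict_Icc]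
  · have : (fun y : Fin n → ℝ => y i) ∘ reflPoint S = fun y => y i := by
      ext y; simp [reflPoint, h]
    rw [this, hμ.2 i]

lemma IsCopulaMeasure.ae_coord {n : ℕ} {μ : Measure (Fin n → ℝ)} (hμ : IsCopulaMeasure μ)
    (c : Fin n → ℝ) : ∀ᵐ y ∂μ, ∀ i, y i ∈ Set.Icc (0:ℝ) 1 ∧ y i ≠ c i := by
  rw [ae_all_iff]
  intro i
  refine ae_of_ae_map (f := fun y : Fin n → ℝ => y i) (p := fun t => t ∈ Set.Icc (0:ℝ) 1 ∧ t ≠ c i)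
    (measurable_pi_apply i).aemeasurable ?_
  rw [hμ.2 i]
  exact (ae_restrict_mem measurableSet_Icc).and (ae_restrict_of_ae (Measure.ae_ne volume (c i)))

lemma prod_ite_eq_indicator_box {n : ℕ} (x y : Fin n → ℝ) :
    (∏ i, if y i ∈ Set.Icc 0 (x i) then (1:ℝ) else 0) = (box x).indicator 1 y := by
  have h : y ∈ box x ↔ ∀ i, y i ∈ Set.Icc 0 (x i) := Set.mem_univ_pi
  rw [Fintype.prod_ite_zero, Finset.prod_const_one]
  by_cases hy : y ∈ box x
  · rw [if_pos (h.1 hy), Set.indicator_of_mem hy, Pi.one_apply]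
  · rw [if_neg (mt h.2 hy), Set.indicator_of_notMem hy]

lemma boxCdf_eq_integral {n : ℕ} (μ : Measure (Fin n → ℝ)) (x : Fin n → ℝ) :
    boxCdf μ x = ∫ y, (∏ i, if y i ∈ Set.Icc 0 (x i) then (1:ℝ) else 0) ∂μ := by
  simp only [prod_ite_eq_indicator_box]
  exact (integral_indicator_one (measurableSet_box x)).symm

lemma integrable_prod_box {n : ℕ} (μ : Measure (Fin n → ℝ)) [IsProbabilityMeasure μ]
    (x : Fin n → ℝ) :
    Integrable (fun y => ∏ i, if y i ∈ Set.Icc 0 (x i) then (1:ℝ) else 0) μ := by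
  simp only [prod_ite_eq_indicator_box]
  exact (integrable_const (1:ℝ)).indicator (measurableSet_box x)

lemma prod_reflPoint_box {n : ℕ} (S : Finset (Fin n)) {x y : Fin n → ℝ}
    (hy : ∀ i, y i ∈ Set.Icc (0:ℝ) 1 ∧ y i ≠ 1 - x i) :
    (∏ i, if reflPoint S y i ∈ Set.Icc 0 (x i) then (1:ℝ) else 0) =
      ∑ T ∈ S.powerset, (-1 : ℝ) ^ T.card * ∏ i, if y i ∈ Set.Icc 0
        (if i ∈ T then 1 - x i else if i ∈ S then 1 else x i) then (1:ℝ) else 0 := by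
  rw [← Finset.prod_mul_prod_compl S]
  have h1 : ∏ i ∈ S, (if reflPoint S y i ∈ Set.Icc 0 (x i) then (1:ℝ) else 0) =
      ∏ i ∈ S, (1 - if y i ∈ Set.Icc 0 (1 - x i) then (1:ℝ) else 0) := by
    refine Finset.prod_congr rfl fun i hi => ?_
    obtain ⟨⟨h0, h1⟩, hne⟩ := hy i
    simp only [reflPoint, hi, if_true, Set.mem_Icc]
    rcases lt_or_gt_of_ne hne with h | h
    · rw [if_neg (by intro h'; linarith [h'.2]), if_pos ⟨h0, h.le⟩, sub_self]
    · rw [if_pos ⟨by linarith, by linarith⟩, if_neg (by intro h'; linarith [h'.2]), sub_zero]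
  rw [h1, Finset.prod_sub, Finset.sum_mul]
  refine Finset.sum_congr rfl fun T hT => ?_
  have hTS := Finset.mem_powerset.1 hT
  rw [Finset.prod_const_one, mul_one, mul_assoc]
  congr 1
  rw [← Finset.prod_mul_prod_compl S (fun i => if y i ∈ Set.Icc 0
        (if i ∈ T then 1 - x i else if i ∈ S then 1 else x i) then (1:ℝ) else 0),
    ← Finset.prod_sdiff hTS]
  have h2 : ∏ i ∈ S \ T, (if y i ∈ Set.Icc 0
        (if i ∈ T then 1 - x i else if i ∈ S then 1 else x i) then (1:ℝ) else 0) = 1 := by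
    refine Finset.prod_eq_one fun i hi => ?_
    obtain ⟨hiS, hiT⟩ := Finset.mem_sdiff.1 hi
    simp only [hiS, hiT, if_true, if_false]
    exact if_pos (hy i).1
  rw [h2, one_mul]
  congr 1
  · refine Finset.prod_congr rfl fun i hi => ?_
    simp [hi]
  · refine Finset.prod_congr rfl fun i hi => ?_
    have hiS := Finset.mem_compl.1 hi
    have hiT : i ∉ T := fun h => hiS (hTS h)
    simp [reflPoint, hiS, hiT]

lemma reflTrans_boxCdf {n : ℕ} {μ : Measure (Fin n → ℝ)} (hμ : IsCopulaMeasure μ)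
    (S : Finset (Fin n)) : reflTrans S (boxCdf μ) = boxCdf (reflMeasure S μ) := by
  ext x
  have := hμ.1
  have hR : boxCdf (reflMeasure S μ) x =
      ∫ y, (∏ i, if reflPoint S y i ∈ Set.Icc 0 (x i) then (1:ℝ) else 0) ∂μ := by
    simp only [prod_ite_eq_indicator_box]
    rw [boxCdf, reflMeasure, map_measureReal_apply (measurable_reflPoint S) (measurableSet_box x)]
    exact (integral_indicator_one (measurable_reflPoint S (measurableSet_box x))).symm
  rw [hR, integral_congr_ae ((hμ.ae_coord fun i => 1 - x i).mono fun y hy =>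
    prod_reflPoint_box S hy), integral_finsetSum _ fun T _ =>
      (integrable_prod_box μ _).const_mul _]
  simp only [reflTrans, integral_const_mul, boxCdf_eq_integral]

lemma boxCdf_marg {k n : ℕ} {μ : Measure (Fin n → ℝ)} (hμ : IsCopulaMeasure μ)
    {f : Fin k → Fin n} {z : Fin n → ℝ} {x : Fin k → ℝ} (hf : ∀ j, z (f j) = x j)
    (hz : ∀ i, (∀ j, f j ≠ i) → z i = 1) :
    boxCdf μ z = boxCdf (margMeasure f μ) x := by
  rw [boxCdf, boxCdf, margMeasure,
    map_measureReal_apply (measurable_comp_index f) (measurableSet_box x)]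
  refine measureReal_congr ?_
  filter_upwards [hμ.ae_coord 0] with y hy
  refine propext ?_
  change y ∈ box z ↔ y ∘ f ∈ box x
  simp only [box, Set.mem_pi, Set.mem_univ, true_imp_iff, Function.comp]
  constructor
  · intro h j
    rw [← hf j]
    exact h (f j)
  · intro h i
    by_cases hi : ∃ j, f j = i
    · obtain ⟨j, rfl⟩ := hi
      rw [hf j]
      exact h j
    · rw [hz i fun j hj => hi ⟨j, hj⟩]
      exact (hy i).1

lemma reflTrans_empty {n : ℕ} (C : (Fin n → ℝ) → ℝ) : reflTrans ∅ C = C := by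
  ext x
  simp [reflTrans]

lemma reflTrans_congr {n : ℕ} {C D : (Fin n → ℝ) → ℝ} (S : Finset (Fin n))
    (h : ∀ x ∈ cube n, C x = D x) {x : Fin n → ℝ} (hx : x ∈ cube n) :
    reflTrans S C x = reflTrans S D x := by
  refine Finset.sum_congr rfl fun T _ => ?_
  rw [h]
  intro i _
  obtain ⟨h0, h1⟩ := hx i trivial
  dsimp only
  split_ifs
  · exact ⟨by linarith, by linarith⟩
  · exact ⟨zero_le_one, le_rfl⟩
  · exact ⟨h0, h1⟩

lemma reflMeasure_reflMeasure {n : ℕ} (S T : Finset (Fin n)) (μ : Measure (Fin n → ℝ)) :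
    reflMeasure S (reflMeasure T μ) = reflMeasure (symmDiff S T) μ := by
  rw [reflMeasure, reflMeasure, Measure.map_map (measurable_reflPoint S) (measurable_reflPoint T),
    reflMeasure]
  congr 1
  ext y i
  by_cases hS : i ∈ S <;> by_cases hT : i ∈ T <;>
    simp [reflPoint, hS, hT, Finset.mem_symmDiff]

lemma margMeasure_reflMeasure_congr {k n : ℕ} (f : Fin k → Fin n) {S S' : Finset (Fin n)}
    (h : ∀ j, f j ∈ S ↔ f j ∈ S') (μ : Measure (Fin n → ℝ)) :
    margMeasure f (reflMeasure S μ) = margMeasure f (reflMeasure S' μ) := by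
  simp only [margMeasure, reflMeasure]
  rw [Measure.map_map (measurable_comp_index f) (measurable_reflPoint S),
    Measure.map_map (measurable_comp_index f) (measurable_reflPoint S')]
  congr 1
  ext y j
  simp [reflPoint, h j]

lemma reflMeasure_margMeasure {k n : ℕ} (f : Fin k → Fin n) {S : Finset (Fin n)}
    {S' : Finset (Fin k)} (h : ∀ j, f j ∈ S ↔ j ∈ S') (μ : Measure (Fin n → ℝ)) :
    reflMeasure S' (margMeasure f μ) = margMeasure f (reflMeasure S μ) := by
  simp only [margMeasure, reflMeasure]
  rw [Measure.map_map (measurable_comp_index f) (measurable_reflPoint S),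
    Measure.map_map (measurable_reflPoint S') (measurable_comp_index f)]
  congr 1
  ext y j
  simp [reflPoint, h j]

lemma margMeasure_margMeasure {l k n : ℕ} (f : Fin k → Fin n) (g : Fin l → Fin k)
    (μ : Measure (Fin n → ℝ)) :
    margMeasure g (margMeasure f μ) = margMeasure (f ∘ g) μ := by
  simp only [margMeasure]
  rw [Measure.map_map (measurable_comp_index g) (measurable_comp_index f)]
  rfl

lemma boxCdf_marg_perm {n : ℕ} (μ : Measure (Fin n → ℝ)) (τ : Equiv.Perm (Fin n)) :
    boxCdf (margMeasure τ μ) = permTrans τ.symm (boxCdf μ) := by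
  ext x
  rw [boxCdf, margMeasure,
    map_measureReal_apply (measurable_comp_index τ) (measurableSet_box x), permTrans, boxCdf]
  congr 1
  ext y
  simp only [box, Set.mem_preimage, Set.mem_pi, Set.mem_univ, true_imp_iff, Function.comp]
  constructor
  · intro h i
    simpa using h (τ.symm i)
  · intro h i
    simpa using h (τ i)

namespace ConcordanceMeasure

variable (κ : ConcordanceMeasure)

lemma kappa_of_lt_two {n : ℕ} (hn : n < 2) (C : (Fin n → ℝ) → ℝ) : κ.κ n C = 0 := by
  interval_cases n
  · exact κ.kappa_zero C
  · exact κ.kappa_one C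

lemma kappa_congr {n : ℕ} {C D : (Fin n → ℝ) → ℝ} (hC : IsCopula C)
    (h : ∀ x ∈ cube n, D x = C x) : κ.κ n D = κ.κ n C := by
  rcases lt_or_ge n 2 with hn | hn
  · rw [κ.kappa_of_lt_two hn, κ.kappa_of_lt_two hn]
  have hD := hC.congr h
  refine le_antisymm (κ.mono n hn D C hD hC (fun x hx => (h x hx).le) fun x hx =>
    (reflTrans_congr _ h hx).le) (κ.mono n hn C D hC hD (fun x hx => (h x hx).ge) fun x hx =>
    (reflTrans_congr _ h hx).ge)

lemma kappa_reflMeasure_univ {n : ℕ} {μ : Measure (Fin n → ℝ)} (hμ : IsCopulaMeasure μ) :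
    κ.κ n (boxCdf (reflMeasure Finset.univ μ)) = κ.κ n (boxCdf μ) := by
  rcases lt_or_ge n 2 with hn | hn
  · rw [κ.kappa_of_lt_two hn, κ.kappa_of_lt_two hn]
  rw [← reflTrans_boxCdf hμ, κ.duality n hn _ hμ.isCopula]

lemma kappa_marg_eq_of_range_eq {k n : ℕ} {μ : Measure (Fin n → ℝ)} (hμ : IsCopulaMeasure μ)
    {f g : Fin k → Fin n} (hf : Function.Injective f) (hg : Function.Injective g)
    (h : Set.range f = Set.range g) :
    κ.κ k (boxCdf (margMeasure f μ)) = κ.κ k (boxCdf (margMeasure g μ)) := by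
  rcases lt_or_ge k 2 with hk | hk
  · rw [κ.kappa_of_lt_two hk, κ.kappa_of_lt_two hk]
  let τ : Equiv.Perm (Fin k) := (Equiv.ofInjective g hg).trans
    ((Equiv.setCongr h.symm).trans (Equiv.ofInjective f hf).symm)
  have hτ : f ∘ τ = g := by
    ext j
    simp [τ, Equiv.apply_ofInjective_symm]
  rw [← hτ, ← margMeasure_margMeasure, boxCdf_marg_perm, κ.permInv k hk _ (hμ.marg f).isCopula]

/-- In dimension two, a reflection in one coordinate changes the sign of `κ`. -/
lemma kappa_two_add_refl {μ : Measure (Fin 2 → ℝ)} (hμ : IsCopulaMeasure μ) :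
    κ.κ 2 (boxCdf μ) + κ.κ 2 (boxCdf (reflMeasure {0} μ)) = 0 := by
  have h := κ.rsp 2 le_rfl _ hμ.isCopula
  simp only [reflTrans_boxCdf hμ] at h
  have huniv : (Finset.univ : Finset (Finset (Fin 2))) = {∅, {0}, {1}, Finset.univ} := by decide
  rw [huniv, Finset.sum_insert (by decide), Finset.sum_insert (by decide),
    Finset.sum_insert (by decide), Finset.sum_singleton, κ.kappa_reflMeasure_univ hμ,
    ← reflTrans_boxCdf hμ ∅, reflTrans_empty, ← κ.kappa_reflMeasure_univ (hμ.refl {1}),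
    reflMeasure_reflMeasure] at h
  have hs : symmDiff (Finset.univ : Finset (Fin 2)) {1} = {0} := by decide
  rw [hs] at h
  linarith

/-- The value of `κ` on the margin of `μ` in the coordinates of `A`. -/
def kappaMarg {n : ℕ} (A : Finset (Fin n)) (μ : Measure (Fin n → ℝ)) : ℝ :=
  κ.κ A.card (boxCdf (margMeasure (A.orderEmbOfFin rfl) μ))

lemma kappaMarg_eq {k n : ℕ} {μ : Measure (Fin n → ℝ)} (hμ : IsCopulaMeasure μ)
    {A : Finset (Fin n)} {f : Fin k → Fin n} (hf : Function.Injective f)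
    (hA : Set.range f = A) : κ.kappaMarg A μ = κ.κ k (boxCdf (margMeasure f μ)) := by
  have hk : A.card = k := by
    have : A = Finset.univ.map ⟨f, hf⟩ := by
      apply Finset.coe_injective
      simp [hA]
    rw [this]
    simp
  subst hk
  exact κ.kappa_marg_eq_of_range_eq hμ (f := ⇑(A.orderEmbOfFin rfl))
    (A.orderEmbOfFin rfl).injective hf
    (by rw [Finset.range_orderEmbOfFin, hA])

lemma kappaMarg_refl_congr {n : ℕ} {A S S' : Finset (Fin n)} (h : S ∩ A = S' ∩ A)
    (μ : Measure (Fin n → ℝ)) :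
    κ.kappaMarg A (reflMeasure S μ) = κ.kappaMarg A (reflMeasure S' μ) := by
  rw [kappaMarg, kappaMarg, margMeasure_reflMeasure_congr]
  intro j
  have hj := A.orderEmbOfFin_mem rfl j
  simpa [hj] using Finset.ext_iff.1 h (A.orderEmbOfFin rfl j)

lemma kappaMarg_refl_univ {n : ℕ} {μ : Measure (Fin n → ℝ)} (hμ : IsCopulaMeasure μ)
    (A : Finset (Fin n)) :
    κ.kappaMarg A (reflMeasure Finset.univ μ) = κ.kappaMarg A μ := by
  rw [kappaMarg, ← reflMeasure_margMeasure (S' := Finset.univ) _ (by simp),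
    κ.kappa_reflMeasure_univ (hμ.marg _), kappaMarg]

lemma kappaMarg_transition {n : ℕ} {μ : Measure (Fin n → ℝ)} (hμ : IsCopulaMeasure μ)
    {A : Finset (Fin n)} {i : Fin n} (hi : i ∉ A) :
    κ.r A.card * κ.kappaMarg A μ =
      κ.kappaMarg (insert i A) μ + κ.kappaMarg (insert i A) (reflMeasure {i} μ) := by
  set f : Fin A.card → Fin n := ⇑(A.orderEmbOfFin rfl) with hf
  have hfr : Set.range f = A := Finset.range_orderEmbOfFin A rfl
  have hfi : Function.Injective f := (A.orderEmbOfFin rfl).injective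
  set g : Fin (A.card + 1) → Fin n := Fin.cons i f with hg
  have hgi : Function.Injective g :=
    Fin.cons_injective_iff.2 ⟨by rw [hfr]; simpa using hi, hfi⟩
  have hgr : Set.range g = (insert i A : Finset (Fin n)) := by
    rw [hg, Fin.range_cons, hfr, Finset.coe_insert]
  have h0 : ∀ j, g j ∈ ({i} : Finset (Fin n)) ↔ j ∈ ({0} : Finset (Fin (A.card + 1))) := by
    intro j
    rw [Finset.mem_singleton, Finset.mem_singleton]
    exact hgi.eq_iff' rfl
  have hgμ := hμ.marg g
  rw [κ.kappaMarg_eq hμ hgi hgr, κ.kappaMarg_eq (hμ.refl {i}) hgi hgr,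
    ← reflMeasure_margMeasure g h0, kappaMarg, ← hf]
  rcases lt_or_ge A.card 2 with hA | hA
  · rw [κ.kappa_of_lt_two hA, mul_zero]
    clear_value f g
    clear hf hg hgr hfr h0 hgi hfi
    generalize A.card = k at *
    interval_cases k
    · rw [κ.kappa_of_lt_two (by norm_num), κ.kappa_of_lt_two (by norm_num), add_zero]
    · exact (κ.kappa_two_add_refl hgμ).symm
  · rw [κ.transition _ hA _ _ (hμ.marg f).isCopula hgμ.isCopula, reflTrans_boxCdf hgμ]
    intro x _
    have hfg : f = g ∘ Fin.succ := by
      ext j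
      simp [hg]
    rw [hfg, ← margMeasure_margMeasure]
    refine (boxCdf_marg hgμ (fun j => ?_) fun j hj => ?_).symm
    · simp
    · rcases Fin.eq_zero_or_eq_succ j with rfl | ⟨j, rfl⟩
      · simp
      · exact absurd rfl (hj j)

/-- Repeated use of the transition property expresses a reflection through lower margins. -/
lemma kappaMarg_refl_eq_sum {n : ℕ} (Q : Finset (Fin n)) :
    ∀ {μ : Measure (Fin n → ℝ)}, IsCopulaMeasure μ → ∀ {A : Finset (Fin n)}, Q ⊆ A →
    κ.kappaMarg A (reflMeasure Q μ) = ∑ P ∈ Q.powerset, (-1 : ℝ) ^ (Q.card + P.card) *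
      (∏ k ∈ Finset.Ico (A.card - P.card) A.card, κ.r k) * κ.kappaMarg (A \ P) μ := by
  induction Q using Finset.induction_on with
  | empty =>
    intro μ _ A _
    have : reflMeasure ∅ μ = μ := by
      have : reflPoint (∅ : Finset (Fin n)) = id := by ext y i; simp [reflPoint]
      rw [reflMeasure, this, Measure.map_id]
    simp [this]
  | insert i Q hi ih =>
    intro μ hμ A hA
    obtain ⟨hiA, hQA⟩ := Finset.insert_subset_iff.1 hA
    have ht := κ.kappaMarg_transition (hμ.refl Q) (Finset.notMem_erase i A)
    have hs : symmDiff {i} Q = insert i Q := by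
      rw [(Finset.disjoint_singleton_left.2 hi).symmDiff_eq_sup]
      rfl
    rw [Finset.insert_erase hiA, reflMeasure_reflMeasure, hs] at ht
    have hc : (A.erase i).card + 1 = A.card := Finset.card_erase_add_one hiA
    rw [← sub_eq_iff_eq_add'.2 ht, ih hμ hQA,
      ih hμ (Finset.subset_erase.2 ⟨hQA, hi⟩), Finset.sum_powerset_insert hi,
      Finset.card_insert_of_notMem hi, Finset.mul_sum, sub_eq_neg_add, ← Finset.sum_neg_distrib]
    congr 1
    · refine Finset.sum_congr rfl fun P _ => ?_
      ring
    · refine Finset.sum_congr rfl fun P hP => ?_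
      have hPi : i ∉ P := fun h => hi (Finset.mem_powerset.1 hP h)
      have he : A.erase i \ P = A \ insert i P := by
        ext j
        simp only [Finset.mem_sdiff, Finset.mem_erase, Finset.mem_insert]
        tauto
      rw [Finset.card_insert_of_notMem hPi, he, ← hc, Nat.add_sub_add_right,
        Finset.prod_Ico_succ_top (Nat.sub_le _ _)]
      ring

lemma kappa_properMarg {n : ℕ} {C : (Fin n → ℝ) → ℝ} {μ : Measure (Fin n → ℝ)}
    (hμ : IsCopulaMeasure μ) (hC : ∀ x ∈ cube n, C x = boxCdf μ x) (P : Finset (Fin n)) :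
    κ.κ Pᶜ.card (properMarg C P) = κ.kappaMarg Pᶜ μ := by
  refine κ.kappa_congr (hμ.marg _).isCopula fun x hx => ?_
  rw [properMarg, hC]
  · refine boxCdf_marg hμ (fun j => ?_) fun i hi => ?_
    · rw [dif_pos (Pᶜ.orderEmbOfFin_mem rfl j)]
      congr 1
      exact (Pᶜ.orderIsoOfFin rfl).symm_apply_apply j
    · refine dif_neg fun h => ?_
      rw [← Finset.mem_coe, ← Finset.range_orderEmbOfFin Pᶜ rfl] at h
      obtain ⟨j, hj⟩ := h
      exact hi j hj
  · intro i _
    dsimp only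
    split_ifs
    · exact hx _ trivial
    · exact ⟨zero_le_one, le_rfl⟩

lemma sum_frakA_eq {n : ℕ} {C : (Fin n → ℝ) → ℝ} {μ : Measure (Fin n → ℝ)}
    (hμ : IsCopulaMeasure μ) (hC : ∀ x ∈ cube n, C x = boxCdf μ x) {R T : Finset (Fin n)} {s : ℕ}
    (hRT : Disjoint R T) (hs : R.card + s = n - T.card) :
    ∑ j ∈ Finset.Icc s (n - T.card), (-1 : ℝ) ^ (R.card + j) * frakA κ C R T j =
      (-1 : ℝ) ^ (n - T.card) * κ.r (n - T.card) * κ.kappaMarg Tᶜ (reflMeasure R μ) := by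
  have hm : Tᶜ.card = n - T.card := by rw [Finset.card_compl, Fintype.card_fin]
  rw [κ.kappaMarg_refl_eq_sum R hμ (Finset.subset_compl_iff_disjoint_right.2 hRT), hm,
    Finset.sum_powerset, Finset.mul_sum]
  generalize hM : n - T.card = m at *
  refine Finset.sum_nbij' (fun j => m - j) (fun j => m - j) ?_ ?_ ?_ ?_ ?_
  · intro j hj; simp only [Finset.mem_Icc, Finset.mem_range] at *; omega
  · intro j hj; simp only [Finset.mem_Icc, Finset.mem_range] at *; omega
  · intro j hj; simp only [Finset.mem_Icc] at *; omega
  · intro j hj; simp only [Finset.mem_range] at *; omega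
  · intro j hj
    obtain ⟨-, hjm⟩ := Finset.mem_Icc.1 hj
    have hj' : n - j - T.card = m - j := by omega
    rw [frakA, hM, hj', Finset.sdiff_eq_self_of_disjoint hRT,
      ← Finset.prod_Ico_mul_eq_prod_Icc hjm, Finset.mul_sum, Finset.mul_sum, Finset.mul_sum]
    refine Finset.sum_congr rfl fun P hP => ?_
    have hcard := (Finset.mem_powersetCard.1 hP).2
    have hset : (P ∪ T)ᶜ = Tᶜ \ P := by
      ext i
      simp only [Finset.mem_compl, Finset.mem_union, Finset.mem_sdiff]
      tauto
    have hsign : (-1 : ℝ) ^ (R.card + j) = (-1) ^ m * (-1) ^ (R.card + (m - j)) := by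
      rw [← pow_add, neg_one_pow_eq_pow_mod_two, neg_one_pow_eq_pow_mod_two (n := m + _)]
      congr 1
      omega
    rw [κ.kappa_properMarg hμ hC, hset, hcard, Nat.sub_sub_self hjm, hsign]
    ring

end ConcordanceMeasure

/-- Complementarity principle (Theorem 4.5 of Taylor):
`∑_{j=s}^{n-t} (-1)^{r+j} 𝔄_j^R(C_T) = ∑_{j=r}^{n-t} (-1)^{s+j} 𝔄_j^S(C_T)`
for `R + S + T = {1,…,n}` pairwise disjoint. -/
theorem stmt15 (κ : ConcordanceMeasure) {n : ℕ} (hn : 2 ≤ n)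
    (C : (Fin n → ℝ) → ℝ) (hC : IsCopula C) (R S T : Finset (Fin n))
    (hRS : Disjoint R S) (hRT : Disjoint R T) (hST : Disjoint S T)
    (hunion : R ∪ S ∪ T = Finset.univ) :
    ∑ j ∈ Finset.Icc S.card (n - T.card), (-1 : ℝ) ^ (R.card + j) * frakA κ C R T j =
    ∑ j ∈ Finset.Icc R.card (n - T.card), (-1 : ℝ) ^ (S.card + j) * frakA κ C S T j := by
  obtain ⟨μ, hμ, hCμ⟩ := hC.exists_measure
  have hcard : R.card + S.card + T.card = n := by
    rw [← Finset.card_union_of_disjoint hRS,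
      ← Finset.card_union_of_disjoint (Finset.disjoint_union_left.2 ⟨hRT, hST⟩), hunion,
      Finset.card_univ, Fintype.card_fin]
  rw [κ.sum_frakA_eq hμ hCμ hRT (by omega), κ.sum_frakA_eq hμ hCμ hST (by omega),
    ← κ.kappaMarg_refl_univ (hμ.refl R), reflMeasure_reflMeasure]
  congr 1
  refine κ.kappaMarg_refl_congr ?_ μ
  ext i
  have hi := Finset.mem_univ i
  rw [← hunion] at hi
  have h1 : i ∈ R → i ∉ S := fun h => Finset.disjoint_left.1 hRS h
  have h2 : i ∈ S → i ∉ T := fun h => Finset.disjoint_left.1 hST h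
  simp only [Finset.mem_union, Finset.mem_inter, Finset.mem_symmDiff, Finset.mem_univ,
    Finset.mem_compl] at hi ⊢
  tauto


end
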